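/- Let R₀ > 0, θ ∈ [0,1], δ₁ ∈ (0,1/2], and let g : ℝ → ℝ be a smooth function with 0 ≤ g ≤ 1, g(t) = 0 for t ≤ 0, and g(t) = 1 for t ≥ δ₁/2. For R > 0 define φ^R : ℝ² → ℝ by φ^R(x) = g(R^{−θ}(R − |x|)). Let ω : ℝ² → ℝ be continuously differentiable with support contained in B(0,R₀), set m = ∫_{ℝ²} ω, let u(x) = (1/(2π)) ∫_{ℝ²} ((x−y)^⊥/|x−y|²) ω(y) dy, let ψ_R(x) = (1/(2π)) ∫_{ℝ²} log|x−y| ω(y) dy − (m/(2π)) log R, and let T_R u = ∇^⊥(φ^R ψ_R). Then there exists a constant C > 0, depending only on R₀, θ, δ₁ and g, such that for every R ≥ max(4R₀, 1) and every x ∈ B(0,R): ‖D(T_R u)(x)‖ ≤ sup_{y ∈ ℝ²} ‖Du(y)‖ + C ( sup_{y ∈ ℝ²} |u(y)| + ‖ω‖_{L¹(ℝ²)} ) R^{−θ}, where D denotes the (Fréchet) derivative. -/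

import Mathlib

open MeasureTheory Real

/-- The perpendicular `z^⊥ = (-z₂, z₁)` of a vector in `ℝ²`. -/
noncomputable def perp (z : EuclideanSpace ℝ (Fin 2)) : EuclideanSpace ℝ (Fin 2) :=
  (EuclideanSpace.equiv (Fin 2) ℝ).symm ![-z 1, z 0]

/-- The perpendicular gradient `∇^⊥ f = (−∂₂f, ∂₁f)` of a scalar function on `ℝ²`. -/
noncomputable def perpGrad (f : EuclideanSpace ℝ (Fin 2) → ℝ)
    (x : EuclideanSpace ℝ (Fin 2)) : EuclideanSpace ℝ (Fin 2) :=
  (EuclideanSpace.equiv (Fin 2) ℝ).symm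
    ![-(fderiv ℝ f x (EuclideanSpace.single 1 1)),
      fderiv ℝ f x (EuclideanSpace.single 0 1)]

/-- The two-dimensional Biot–Savart law
`u(x) = (1/(2π)) ∫ ((x−y)^⊥/|x−y|²) ω(y) dy`. -/
noncomputable def biotSavart2D (ω : EuclideanSpace ℝ (Fin 2) → ℝ)
    (x : EuclideanSpace ℝ (Fin 2)) : EuclideanSpace ℝ (Fin 2) :=
  (1 / (2 * π)) • ∫ y, (ω y / ‖x - y‖ ^ 2) • perp (x - y)

/-- The stream function of `ω` normalized so that it vanishes at `|x| = R`
when `ω` is radial: `ψ_R(x) = (1/(2π)) ∫ log|x−y| ω(y) dy − (m/(2π)) log R`. -/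
noncomputable def streamR (ω : EuclideanSpace ℝ (Fin 2) → ℝ) (m R : ℝ)
    (x : EuclideanSpace ℝ (Fin 2)) : ℝ :=
  (1 / (2 * π)) * (∫ y, Real.log ‖x - y‖ * ω y) - (m / (2 * π)) * Real.log R

/-- The boundary-layer cutoff `φ^R(x) = g(R^{−θ}(R − |x|))`. -/
noncomputable def cutoff (g : ℝ → ℝ) (θ R : ℝ) (x : EuclideanSpace ℝ (Fin 2)) : ℝ :=
  g (R ^ (-θ) * (R - ‖x‖))

/-- The truncation operator `T_R u = ∇^⊥(φ^R ψ_R)`. -/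
noncomputable def truncate (g : ℝ → ℝ) (θ R : ℝ) (ω : EuclideanSpace ℝ (Fin 2) → ℝ)
    (m : ℝ) : EuclideanSpace ℝ (Fin 2) → EuclideanSpace ℝ (Fin 2) :=
  perpGrad (fun x => cutoff g θ R x * streamR ω m R x)


abbrev E2 := EuclideanSpace ℝ (Fin 2)

lemma q_integrableOn_ball (r : ℝ) : IntegrableOn (fun z : E2 => ‖z‖⁻¹) (Metric.ball 0 r) := by
  rw [integrableOn_fun_norm_addHaar volume (f := fun t : ℝ => t⁻¹)]
  have : IntegrableOn (fun _ : ℝ => (1:ℝ)) (Set.Ioo 0 r) := by simp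
  refine this.congr_fun ?_ measurableSet_Ioo
  intro t ht
  have := ht.1.ne'
  simp [this]

lemma q_locInt : LocallyIntegrable (fun z : E2 => ‖z‖⁻¹) := by
  intro x
  refine ⟨Metric.ball 0 (‖x‖ + 1), Metric.isOpen_ball.mem_nhds (by simp), q_integrableOn_ball _⟩

lemma locInt_of_bound {F : Type*} [NormedAddCommGroup F] (k : E2 → F)
    (hm : AEStronglyMeasurable k) (h : ∀ z, ‖k z‖ ≤ ‖z‖⁻¹ + ‖z‖ ^ 2 + 1) : LocallyIntegrable k := by
  have h1 : LocallyIntegrable (fun z : E2 => ‖z‖ ^ 2 + 1) :=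
    (by fun_prop : Continuous (fun z : E2 => ‖z‖ ^ 2 + 1)).locallyIntegrable
  refine (q_locInt.add h1).mono hm (Filter.Eventually.of_forall fun z => ?_)
  refine (h z).trans ((le_of_eq ?_).trans (le_abs_self _))
  simp [add_assoc]

/-- integrability of `f y * ‖x-y‖⁻¹`, with a uniform bound. -/
lemma q_conv_bound (f : E2 → ℝ) (hf : Continuous f) (hc : HasCompactSupport f) :
    (∀ x, Integrable (fun y => f y * ‖x - y‖⁻¹)) ∧
    ∃ M, ∀ x, ∫ y, |f y| * ‖x - y‖⁻¹ ≤ M := by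
  have key : ∀ h : E2 → ℝ, Continuous h → HasCompactSupport h →
      ∀ x, Integrable (fun y => h y * ‖x - y‖⁻¹) := fun h hh hhc x =>
    (hhc.convolutionExists_left (ContinuousLinearMap.mul ℝ ℝ) hh q_locInt) x
  refine ⟨key f hf hc, ?_⟩
  obtain ⟨B, hB⟩ := hc.exists_bound_of_continuous hf
  have hB0 : 0 ≤ B := (norm_nonneg _).trans (hB 0)
  refine ⟨B * (∫ z in Metric.ball (0:E2) 1, ‖z‖⁻¹) + ∫ y, |f y|, fun x => ?_⟩
  have hi1 : Integrable (fun z : E2 => (Metric.ball (0:E2) 1).indicator (fun z => ‖z‖⁻¹) z) :=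
    (integrable_indicator_iff measurableSet_ball).2 (q_integrableOn_ball 1)
  have hi1' := hi1.comp_sub_left x
  have hfi : Integrable (fun y => |f y|) := (hf.integrable_of_hasCompactSupport hc).abs
  have hca : HasCompactSupport (fun y => |f y|) := hc.norm
  calc ∫ y, |f y| * ‖x - y‖⁻¹
      ≤ ∫ y, (B * (Metric.ball (0:E2) 1).indicator (fun z => ‖z‖⁻¹) (x - y) + |f y|) := by
        refine integral_mono (key _ hf.abs hca x) ((hi1'.const_mul B).add hfi) fun y => ?_
        by_cases hy : x - y ∈ Metric.ball (0:E2) 1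
        · simp only [Set.indicator_of_mem hy]
          have := mul_le_mul_of_nonneg_right (hB y) (inv_nonneg.2 (norm_nonneg (x - y)))
          rw [Real.norm_eq_abs] at this
          linarith [abs_nonneg (f y)]
        · simp only [Set.indicator_of_notMem hy, mul_zero, zero_add]
          have h1 : 1 ≤ ‖x - y‖ := by simpa using hy
          exact mul_le_of_le_one_right (abs_nonneg _) (inv_le_one_of_one_le₀ h1)
    _ = _ := by
        rw [integral_add (hi1'.const_mul B) hfi, integral_const_mul,
          integral_sub_left_eq_self (fun z => (Metric.ball (0:E2) 1).indicator (fun z => ‖z‖⁻¹) z),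
          integral_indicator measurableSet_ball]

noncomputable def perpL : E2 →L[ℝ] E2 :=
  LinearMap.toContinuousLinearMap
    { toFun := perp
      map_add' := by
        intro x y; ext i; fin_cases i <;> simp [perp]; ring
      map_smul' := by
        intro c y; ext i; fin_cases i <;> simp [perp] }

lemma perpL_apply (z : E2) : perpL z = perp z := rfl

lemma norm_perp (z : E2) : ‖perp z‖ = ‖z‖ := by
  simp [EuclideanSpace.norm_eq, perp, Fin.sum_univ_two, add_comm]

noncomputable def kern (z : E2) : E2 := (‖z‖ ^ 2)⁻¹ • perp z

lemma norm_kern (z : E2) : ‖kern z‖ = ‖z‖⁻¹ := by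
  by_cases h : ‖z‖ = 0
  · simp [kern, h]
  · rw [kern, norm_smul, norm_perp]
    simp
    field_simp

lemma kern_meas : AEStronglyMeasurable kern (volume : Measure E2) := by
  have : Measurable kern := by
    have h2 : Measurable perp := perpL.continuous.measurable
    unfold kern
    fun_prop
  exact this.aestronglyMeasurable

lemma kern_locInt : LocallyIntegrable kern :=
  locInt_of_bound _ kern_meas (fun z => by rw [norm_kern]; nlinarith [sq_nonneg ‖z‖])

open scoped Convolution in
lemma biot_eq (ω : E2 → ℝ) :
    biotSavart2D ω = fun x => (1 / (2 * π)) • (ω ⋆[ContinuousLinearMap.lsmul ℝ ℝ, volume] kern) x := by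
  funext x
  simp [biotSavart2D, convolution, kern, smul_smul, div_eq_mul_inv, mul_comm]

lemma biot_bdd (ω : E2 → ℝ) (hω : ContDiff ℝ 1 ω) (hc : HasCompactSupport ω) :
    BddAbove (Set.range fun y => ‖biotSavart2D ω y‖) := by
  obtain ⟨hI, M, hM⟩ := q_conv_bound ω hω.continuous hc
  refine ⟨‖1 / (2 * π)‖ * M, ?_⟩
  rintro _ ⟨x, rfl⟩
  rw [biot_eq]
  simp only [norm_smul]
  gcongr
  refine le_trans ?_ (hM x)
  refine (norm_integral_le_integral_norm _).trans (le_of_eq ?_)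
  simp [norm_smul, norm_kern]

lemma biot_contDiff (ω : E2 → ℝ) (hω : ContDiff ℝ 1 ω) (hc : HasCompactSupport ω) :
    ContDiff ℝ 1 (biotSavart2D ω) := by
  rw [biot_eq]
  let L : ℝ →L[ℝ] E2 →L[ℝ] E2 := ContinuousLinearMap.lsmul ℝ ℝ
  have h := hc.contDiff_convolution_left L hω kern_locInt
  exact h.const_smul (1 / (2 * π))

lemma biot_fderiv_bdd (ω : E2 → ℝ) (hω : ContDiff ℝ 1 ω) (hc : HasCompactSupport ω) :
    BddAbove (Set.range fun y => ‖fderiv ℝ (biotSavart2D ω) y‖) := by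
  have hc' := hc.fderiv ℝ
  have hcont := hω.continuous_fderiv one_ne_zero
  obtain ⟨hI, M, hM⟩ := q_conv_bound (fun y => ‖fderiv ℝ ω y‖) hcont.norm hc'.norm
  let L := (ContinuousLinearMap.lsmul ℝ ℝ : ℝ →L[ℝ] E2 →L[ℝ] E2)
  refine ⟨‖1 / (2 * π)‖ * (‖L.precompL E2‖ * M), ?_⟩
  rintro _ ⟨x, rfl⟩
  have h := (hc.hasFDerivAt_convolution_left L hω kern_locInt x).const_smul (1 / (2 * π))
  rw [biot_eq]
  have h2 := h.fderiv
  dsimp only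
  erw [h2]
  rw [norm_smul]
  gcongr
  refine le_trans ?_ (mul_le_mul_of_nonneg_left (hM x) (ContinuousLinearMap.opNorm_nonneg _))
  rw [← integral_const_mul]
  refine norm_integral_le_of_norm_le ?_ (Filter.Eventually.of_forall fun y => ?_)
  · simpa using (hI x).const_mul _
  · refine (ContinuousLinearMap.le_opNorm₂ _ _ _).trans (le_of_eq ?_)
    simp [norm_kern, mul_assoc]

/-- `w ↦ (v ↦ w₁ v₀ - w₀ v₁)` -/
noncomputable def Aop (w : E2) : E2 →L[ℝ] ℝ :=
  w 1 • (EuclideanSpace.proj 0 : E2 →L[ℝ] ℝ) - w 0 • (EuclideanSpace.proj 1 : E2 →L[ℝ] ℝ)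

lemma Aop_apply (w v : E2) : Aop w v = w 1 * v 0 - w 0 * v 1 := by
  simp [Aop]

lemma Aop_eq (w v : E2) : Aop w v = - inner ℝ (perp w) v := by
  rw [Aop_apply]; simp [PiLp.inner_apply, Fin.sum_univ_two, perp]; ring

lemma Aop_norm (w : E2) : ‖Aop w‖ ≤ ‖w‖ := by
  refine ContinuousLinearMap.opNorm_le_bound _ (norm_nonneg _) fun v => ?_
  rw [Aop_eq, norm_neg, ← norm_perp w]
  exact norm_inner_le_norm _ _

noncomputable def Lg (ε : ℝ) (z : E2) : ℝ := (1 / 2) * Real.log (‖z‖ ^ 2 + ε ^ 2)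

lemma Lg_hasFDerivAt (ε : ℝ) (hε : 0 < ε) (z : E2) :
    HasFDerivAt (Lg ε) ((‖z‖ ^ 2 + ε ^ 2)⁻¹ • innerSL ℝ z) z := by
  have h := ((hasStrictFDerivAt_norm_sq z).hasFDerivAt.add_const (ε ^ 2)).log
    (by positivity)
  have h2 := h.const_mul (1 / 2)
  refine h2.congr_fderiv ?_
  ext v
  simp
  ring

lemma Lg_cont (ε : ℝ) (hε : 0 < ε) : Continuous (Lg ε) :=
  continuous_iff_continuousAt.2 fun z => (Lg_hasFDerivAt ε hε z).continuousAt

lemma log_bound {t : ℝ} (ht : 0 ≤ t) : |Real.log t| ≤ t⁻¹ + t ^ 2 + 1 := by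
  rcases ht.eq_or_lt with h | h
  · simp [← h]
  · have h1 := Real.log_le_sub_one_of_pos h
    have h2 := Real.log_le_sub_one_of_pos (inv_pos.2 h)
    rw [Real.log_inv] at h2
    have := inv_pos.2 h
    rw [abs_le]; constructor <;> nlinarith [sq_nonneg t, sq_nonneg (t-1)]

lemma Lg_bound (ε : ℝ) (hε : 0 < ε) (hε1 : ε ≤ 1) (z : E2) (hz : z ≠ 0) :
    |Lg ε z| ≤ ‖z‖⁻¹ + ‖z‖ ^ 2 + 1 := by
  have hp : 0 < ‖z‖ := norm_pos_iff.2 hz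
  have h0 := log_bound hp.le
  have hl : Real.log ‖z‖ ≤ Lg ε z := by
    have : Real.log (‖z‖ ^ 2) ≤ Real.log (‖z‖ ^ 2 + ε ^ 2) :=
      Real.log_le_log (by positivity) (by nlinarith)
    rw [Real.log_pow] at this
    unfold Lg
    push_cast at this
    linarith
  have hu : Lg ε z ≤ ‖z‖ ^ 2 + 1 := by
    have := Real.log_le_sub_one_of_pos (show 0 < ‖z‖ ^ 2 + ε ^ 2 by positivity)
    unfold Lg
    nlinarith
  have := inv_pos.2 hp
  rw [abs_le] at h0 ⊢
  constructor <;> linarith [h0.1]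

lemma log_locInt : LocallyIntegrable (fun z : E2 => Real.log ‖z‖) :=
  locInt_of_bound _ (Real.measurable_log.comp measurable_norm).aestronglyMeasurable
    (fun z => log_bound (norm_nonneg z))

lemma bnd_locInt : LocallyIntegrable (fun z : E2 => ‖z‖⁻¹ + ‖z‖ ^ 2 + 1) :=
  locInt_of_bound _ (by fun_prop) (fun z => by
    rw [Real.norm_eq_abs, abs_of_nonneg (by positivity)])

lemma conv_int (f k : E2 → ℝ) (hf : Continuous f) (hc : HasCompactSupport f)
    (hk : LocallyIntegrable k) (x : E2) : Integrable (fun y => f y * k (x - y)) :=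
  (hc.convolutionExists_left (ContinuousLinearMap.mul ℝ ℝ) hf hk) x

lemma ae_ne (x : E2) : ∀ᵐ y : E2, x - y ≠ 0 := by
  have : ∀ᵐ y : E2, y ≠ x := by
    rw [ae_iff]; simp
  filter_upwards [this] with y hy h
  exact hy (sub_eq_zero.1 h).symm

/-- integration by parts against the regularised logarithm. -/
lemma ibp (ω : E2 → ℝ) (hω : ContDiff ℝ 1 ω) (hc : HasCompactSupport ω) (x v : E2)
    (ε : ℝ) (hε : 0 < ε) :
    ∫ y, fderiv ℝ ω y v * Lg ε (x - y) =
      ∫ y, ω y * ((‖x - y‖ ^ 2 + ε ^ 2)⁻¹ * inner ℝ (x - y) v) := by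
  have hd : ∀ y, HasFDerivAt (fun y => Lg ε (x - y))
      (-((‖x - y‖ ^ 2 + ε ^ 2)⁻¹ • innerSL ℝ (x - y))) y := by
    intro y
    have h := (Lg_hasFDerivAt ε hε (x - y)).comp y ((hasFDerivAt_id y).const_sub x)
    refine h.congr_fderiv ?_
    ext w; simp
  have hfd : ∀ y, fderiv ℝ (fun y => Lg ε (x - y)) y v =
      -((‖x - y‖ ^ 2 + ε ^ 2)⁻¹ * inner ℝ (x - y) v) := by
    intro y; rw [(hd y).fderiv]; simp [-map_sub]
  have hLc : Continuous (fun y => Lg ε (x - y)) := (Lg_cont ε hε).comp (by fun_prop)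
  have hωc := hω.continuous
  have hωd := hω.continuous_fderiv one_ne_zero
  have hKc : Continuous (fun y => (‖x - y‖ ^ 2 + ε ^ 2)⁻¹ * inner ℝ (x - y) v) := by
    refine Continuous.mul (Continuous.inv₀ (by fun_prop) fun y => by positivity) (by fun_prop)
  have h := integral_mul_fderiv_eq_neg_fderiv_mul_of_integrable (μ := (volume : Measure E2))
    (f := fun y => Lg ε (x - y)) (g := ω) (v := v) ?_ ?_ ?_
    (fun y _ => (hd y).differentiableAt) (fun y _ => (hω.differentiable one_ne_zero) y)
  · simp only [hfd] at h
    simp only [mul_comm (fderiv ℝ ω _ v), h, ← integral_neg]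
    congr 1; ext y; ring
  · simp only [hfd]
    exact (hKc.neg.mul hωc).integrable_of_hasCompactSupport hc.mul_left
  · refine (hLc.mul (hωd.clm_apply continuous_const)).integrable_of_hasCompactSupport ?_
    exact (hc.fderiv_apply ℝ v).mul_left
  · exact (hLc.mul hωc).integrable_of_hasCompactSupport hc.mul_left

lemma ibp_lim (ω : E2 → ℝ) (hω : ContDiff ℝ 1 ω) (hc : HasCompactSupport ω) (x v : E2) :
    ∫ y, fderiv ℝ ω y v * Real.log ‖x - y‖ =
      ∫ y, ω y * ((‖x - y‖ ^ 2)⁻¹ * inner ℝ (x - y) v) := by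
  have hωc := hω.continuous
  have hωd : Continuous (fun y => fderiv ℝ ω y v) :=
    (hω.continuous_fderiv one_ne_zero).clm_apply continuous_const
  have hcd : HasCompactSupport (fun y => fderiv ℝ ω y v) := hc.fderiv_apply ℝ v
  let e : ℕ → ℝ := fun n => 1 / ((n:ℝ) + 1)
  have he0 : ∀ n, 0 < e n := fun n => by positivity
  have he1 : ∀ n, e n ≤ 1 := fun n => by
    simp only [e]; rw [div_le_one (by positivity)]; linarith [n.cast_nonneg (α := ℝ)]
  have het : Filter.Tendsto e Filter.atTop (nhds 0) := tendsto_one_div_add_atTop_nhds_zero_nat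
  have hq : ∀ y : E2, Filter.Tendsto (fun n => ‖x - y‖ ^ 2 + e n ^ 2) Filter.atTop
      (nhds (‖x - y‖ ^ 2)) := fun y => by
    simpa using (tendsto_const_nhds (x := ‖x - y‖ ^ 2)).add (het.pow 2)
  have h1 : Filter.Tendsto (fun n => ∫ y, fderiv ℝ ω y v * Lg (e n) (x - y)) Filter.atTop
      (nhds (∫ y, fderiv ℝ ω y v * Real.log ‖x - y‖)) := by
    refine tendsto_integral_of_dominated_convergence
      (fun y => |fderiv ℝ ω y v| * (‖x - y‖⁻¹ + ‖x - y‖ ^ 2 + 1)) ?_ ?_ ?_ ?_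
    · intro n
      exact (hωd.mul ((Lg_cont _ (he0 n)).comp (by fun_prop))).aestronglyMeasurable
    · exact conv_int _ _ hωd.abs hcd.norm bnd_locInt x
    · intro n
      filter_upwards [ae_ne x] with y hy
      rw [norm_mul, Real.norm_eq_abs, Real.norm_eq_abs]
      gcongr
      exact Lg_bound _ (he0 n) (he1 n) _ hy
    · filter_upwards [ae_ne x] with y hy
      refine Filter.Tendsto.const_mul _ ?_
      have hp : ‖x - y‖ ≠ 0 := norm_ne_zero_iff.2 hy
      have := ((hq y).log (by positivity)).const_mul (1/2)
      have h3 : 1 / 2 * Real.log (‖x - y‖ ^ 2) = Real.log ‖x - y‖ := by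
        rw [Real.log_pow]; push_cast; ring
      rw [h3] at this
      exact this
  have h2 : Filter.Tendsto
      (fun n => ∫ y, ω y * ((‖x - y‖ ^ 2 + e n ^ 2)⁻¹ * inner ℝ (x - y) v)) Filter.atTop
      (nhds (∫ y, ω y * ((‖x - y‖ ^ 2)⁻¹ * inner ℝ (x - y) v))) := by
    refine tendsto_integral_of_dominated_convergence
      (fun y => (|ω y| * ‖x - y‖⁻¹) * ‖v‖) ?_ ?_ ?_ ?_
    · intro n
      have := he0 n
      refine Continuous.aestronglyMeasurable (hωc.mul ?_)
      exact Continuous.mul (Continuous.inv₀ (by fun_prop) fun y => by positivity) (by fun_prop)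
    · exact (conv_int _ _ hωc.abs hc.norm q_locInt x).mul_const _
    · intro n
      filter_upwards [ae_ne x] with y hy
      have hp : 0 < ‖x - y‖ := norm_pos_iff.2 hy
      have := he0 n
      rw [norm_mul, norm_mul, mul_assoc, Real.norm_eq_abs (ω y)]
      refine mul_le_mul_of_nonneg_left ?_ (abs_nonneg _)
      calc _ ≤ (‖x - y‖ ^ 2)⁻¹ * (‖x - y‖ * ‖v‖) := by
            gcongr
            · rw [Real.norm_eq_abs, abs_of_pos (by positivity)]
              gcongr
              nlinarith
            · exact norm_inner_le_norm _ _
        _ = _ := by field_simp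
    · filter_upwards [ae_ne x] with y hy
      have hp : ‖x - y‖ ≠ 0 := norm_ne_zero_iff.2 hy
      exact (((hq y).inv₀ (by positivity)).mul_const _).const_mul _
  refine tendsto_nhds_unique h1 ?_
  refine h2.congr fun n => ?_
  exact (ibp ω hω hc x v (e n) (he0 n)).symm

open scoped Convolution in
lemma stream_hasFDerivAt (ω : E2 → ℝ) (hω : ContDiff ℝ 1 ω) (hc : HasCompactSupport ω)
    (m R : ℝ) (x : E2) :
    HasFDerivAt (streamR ω m R) (Aop (biotSavart2D ω x)) x := by
  let L := ContinuousLinearMap.mul ℝ ℝ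
  have h := ((hc.hasFDerivAt_convolution_left L hω log_locInt x).const_mul
    (1 / (2 * π))).sub_const ((m / (2 * π)) * Real.log R)
  have hs : streamR ω m R = fun x => 1 / (2 * π) * (ω ⋆[L, volume] fun z => Real.log ‖z‖) x -
      (m / (2 * π)) * Real.log R := by
    funext x
    simp [streamR, convolution, L, mul_comm]
  rw [hs]
  refine h.congr_fderiv ?_
  ext v
  have hex : Integrable (fun t => (L.precompL E2) (fderiv ℝ ω t) (Real.log ‖x - t‖)) :=
    ((hc.fderiv ℝ).convolutionExists_left (L.precompL E2)
      (hω.continuous_fderiv one_ne_zero) log_locInt) x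
  have hkex : Integrable (fun y => ω y • kern (x - y)) :=
    (hc.convolutionExists_left (ContinuousLinearMap.lsmul ℝ ℝ : ℝ →L[ℝ] E2 →L[ℝ] E2) hω.continuous kern_locInt) x
  rw [Aop_eq]
  have e1 : ((fderiv ℝ ω ⋆[L.precompL E2, volume] fun z => Real.log ‖z‖) x) v =
      ∫ y, fderiv ℝ ω y v * Real.log ‖x - y‖ := by
    rw [convolution, ContinuousLinearMap.integral_apply hex]
    rfl
  have e2 : inner ℝ (perp (biotSavart2D ω x)) v =
      (1 / (2 * π)) * ∫ y, -(ω y * ((‖x - y‖ ^ 2)⁻¹ * inner ℝ (x - y) v)) := by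
    have e3 : perp (biotSavart2D ω x) = (1 / (2 * π)) • ∫ y, perpL (ω y • kern (x - y)) := by
      rw [ContinuousLinearMap.integral_comp_comm _ hkex, biot_eq, ← perpL_apply, map_smul]
      rfl
    rw [e3, inner_smul_left, real_inner_comm, ← integral_inner (perpL.integrable_comp hkex)]
    congr 1
    refine integral_congr_ae (Filter.Eventually.of_forall fun y => ?_)
    simp [perpL_apply, perp, kern, PiLp.inner_apply, Fin.sum_univ_two]
    ring
  rw [e2, integral_neg, ← ibp_lim ω hω hc x v]
  rw [← e1]
  simp

noncomputable def Pop (f' : E2 →L[ℝ] ℝ) : E2 :=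
  (EuclideanSpace.equiv (Fin 2) ℝ).symm
    ![-(f' (EuclideanSpace.single 1 1)), f' (EuclideanSpace.single 0 1)]

lemma perpGrad_eq {f : E2 → ℝ} {f' : E2 →L[ℝ] ℝ} {x : E2} (h : HasFDerivAt f f' x) :
    perpGrad f x = Pop f' := by
  simp [perpGrad, Pop, h.fderiv]

lemma Pop_Aop (w : E2) : Pop (Aop w) = w := by
  ext i; fin_cases i <;> simp [Pop, Aop_apply]

lemma Pop_comb (w x : E2) (a b : ℝ) :
    Pop (a • Aop w + b • innerSL ℝ x) = a • w + b • perp x := by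
  ext i; fin_cases i <;>
    simp [Pop, Aop_apply, perp, PiLp.inner_apply, Fin.sum_univ_two, add_comm]

lemma norm_hasFDerivAt (x : E2) (hx : x ≠ 0) :
    HasFDerivAt (fun y : E2 => ‖y‖) (‖x‖⁻¹ • innerSL ℝ x) x := by
  have hp : 0 < ‖x‖ := norm_pos_iff.2 hx
  have h := (hasStrictFDerivAt_norm_sq x).hasFDerivAt.sqrt (by positivity)
  simp only [Real.sqrt_sq (norm_nonneg _)] at h
  refine h.congr_fderiv ?_
  ext v
  simp
  field_simp

noncomputable def acoef (g : ℝ → ℝ) (θ R : ℝ) (x : E2) : ℝ :=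
  -(R ^ (-θ) * deriv g (R ^ (-θ) * (R - ‖x‖))) * ‖x‖⁻¹

lemma arg_hasFDerivAt (r R : ℝ) (x : E2) (hx : x ≠ 0) :
    HasFDerivAt (fun y : E2 => r * (R - ‖y‖)) (-(r * ‖x‖⁻¹) • innerSL ℝ x) x := by
  refine (((norm_hasFDerivAt x hx).const_sub R).const_mul r).congr_fderiv ?_
  ext v; simp; ring

lemma cutoff_hasFDerivAt (g : ℝ → ℝ) (hg : Differentiable ℝ g) (θ R : ℝ) (x : E2) (hx : x ≠ 0) :
    HasFDerivAt (cutoff g θ R) (acoef g θ R x • innerSL ℝ x) x := by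
  have h := (hg (R ^ (-θ) * (R - ‖x‖))).hasDerivAt.comp_hasFDerivAt x
    (arg_hasFDerivAt (R ^ (-θ)) R x hx)
  refine h.congr_fderiv ?_
  ext v; simp [acoef]; ring

lemma acoef_hasFDerivAt (g : ℝ → ℝ) (hg : Differentiable ℝ (deriv g)) (θ R : ℝ) (x : E2)
    (hx : x ≠ 0) :
    HasFDerivAt (acoef g θ R)
      (((R ^ (-θ)) ^ 2 * deriv (deriv g) (R ^ (-θ) * (R - ‖x‖)) * (‖x‖⁻¹ * ‖x‖⁻¹)
        + (R ^ (-θ) * deriv g (R ^ (-θ) * (R - ‖x‖))) * ((‖x‖ ^ 2)⁻¹ * ‖x‖⁻¹)) • innerSL ℝ x) x := by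
  have hp : ‖x‖ ≠ 0 := norm_ne_zero_iff.2 hx
  have h := (hg (R ^ (-θ) * (R - ‖x‖))).hasDerivAt.comp_hasFDerivAt x
    (arg_hasFDerivAt (R ^ (-θ)) R x hx)
  have hi := (hasDerivAt_inv hp).comp_hasFDerivAt x (norm_hasFDerivAt x hx)
  have h2 := (h.const_mul (R ^ (-θ))).neg.mul hi
  refine h2.congr_fderiv ?_
  ext v; simp; ring

lemma deriv_bdd (f : ℝ → ℝ) (c d b : ℝ) (hf : Continuous (deriv f))
    (h0 : ∀ t ≤ (0:ℝ), f t = c) (h1 : ∀ t, b ≤ t → f t = d) :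
    (∃ G, ∀ t, |deriv f t| ≤ G) ∧ (∀ t ≤ (0:ℝ), deriv f t = 0) ∧ (∀ t, b ≤ t → deriv f t = 0) := by
  have key0 : ∀ t < (0:ℝ), deriv f t = 0 := fun t ht => by
    have : f =ᶠ[nhds t] fun _ => c := by
      filter_upwards [Iio_mem_nhds ht] with s hs using h0 s (le_of_lt hs)
    rw [this.deriv_eq]; simp
  have key1 : ∀ t, b < t → deriv f t = 0 := fun t ht => by
    have : f =ᶠ[nhds t] fun _ => d := by
      filter_upwards [Ioi_mem_nhds ht] with s hs using h1 s (le_of_lt hs)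
    rw [this.deriv_eq]; simp
  have cl : IsClosed {t | deriv f t = 0} := isClosed_eq hf continuous_const
  refine ⟨?_, ?_, ?_⟩
  · obtain ⟨G, hG⟩ := (isCompact_Icc (a := (0:ℝ)) (b := b)).exists_bound_of_continuousOn
      hf.continuousOn
    refine ⟨max G 0, fun t => ?_⟩
    by_cases h : t ∈ Set.Icc 0 b
    · exact (hG t h).trans (le_max_left _ _)
    · have : deriv f t = 0 := by
        rw [Set.mem_Icc, not_and_or, not_le, not_le] at h
        exact h.elim (key0 t) (key1 t)
      simp [this]
  · intro t ht
    have : closure (Set.Iio (0:ℝ)) ⊆ {t | deriv f t = 0} :=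
      closure_minimal (fun t ht => key0 t ht) cl
    rw [closure_Iio] at this
    exact this ht
  · intro t ht
    have : closure (Set.Ioi b) ⊆ {t | deriv f t = 0} :=
      closure_minimal (fun t ht => key1 t ht) cl
    rw [closure_Ioi] at this
    exact this ht

lemma stream_bound (ω : E2 → ℝ) (hω : ContDiff ℝ 1 ω) (hc : HasCompactSupport ω) (R₀ R : ℝ)
    (hs : Function.support ω ⊆ Metric.closedBall 0 R₀) (hR : 0 < R) (hR0 : 4 * R₀ ≤ R) (x : E2)
    (hx1 : 3 * R / 4 ≤ ‖x‖) (hx2 : ‖x‖ ≤ R) :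
    |streamR ω (∫ y, ω y) R x| ≤ ∫ y, |ω y| := by
  have hi := hω.continuous.integrable_of_hasCompactSupport hc (μ := volume)
  have hli : Integrable (fun y => Real.log ‖x - y‖ * ω y) := by
    simpa only [mul_comm] using conv_int _ _ hω.continuous hc log_locInt x
  have e : streamR ω (∫ y, ω y) R x =
      (1 / (2 * π)) * ∫ y, (Real.log ‖x - y‖ * ω y - Real.log R * ω y) := by
    rw [integral_sub hli (hi.const_mul _), integral_const_mul, streamR]
    ring
  have hb : |∫ y, (Real.log ‖x - y‖ * ω y - Real.log R * ω y)| ≤ ∫ y, |ω y| := by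
    rw [← Real.norm_eq_abs]
    refine norm_integral_le_of_norm_le hi.abs (Filter.Eventually.of_forall fun y => ?_)
    by_cases hy : ω y = 0
    · simp [hy]
    have hy' : ‖y‖ ≤ R₀ := by simpa using hs (Function.mem_support.2 hy)
    have t1 : ‖x‖ - ‖y‖ ≤ ‖x - y‖ := norm_sub_norm_le x y
    have t2 : ‖x - y‖ ≤ ‖x‖ + ‖y‖ := norm_sub_le x y
    have hp : 0 < ‖x - y‖ := by linarith
    rw [← sub_mul, ← Real.log_div hp.ne' hR.ne', norm_mul, Real.norm_eq_abs, Real.norm_eq_abs]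
    refine mul_le_of_le_one_left (abs_nonneg _) ?_
    have hq : 0 < ‖x - y‖ / R := by positivity
    have l1 := Real.log_le_sub_one_of_pos hq
    have l2 := Real.log_le_sub_one_of_pos (inv_pos.2 hq)
    rw [Real.log_inv, inv_div] at l2
    have b1 : ‖x - y‖ / R ≤ 2 := by rw [div_le_iff₀ hR]; linarith
    have b2 : R / ‖x - y‖ ≤ 2 := by rw [div_le_iff₀ hp]; linarith
    rw [abs_le]; constructor <;> linarith
  rw [e, abs_mul]
  have : |1 / (2 * π)| ≤ 1 := by
    rw [abs_of_pos (by positivity), div_le_one (by positivity)]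
    linarith [Real.pi_gt_three]
  exact (mul_le_of_le_one_left (abs_nonneg _) this).trans hb

lemma truncate_near (g : ℝ → ℝ) (hg : Differentiable ℝ g) (θ R m : ℝ) (ω : E2 → ℝ)
    (hω : ContDiff ℝ 1 ω) (hc : HasCompactSupport ω) (x : E2) (hx : x ≠ 0) :
    truncate g θ R ω m x = cutoff g θ R x • biotSavart2D ω x +
      (streamR ω m R x * acoef g θ R x) • perp x := by
  have h := (cutoff_hasFDerivAt g hg θ R x hx).mul (stream_hasFDerivAt ω hω hc m R x)
  rw [smul_smul] at h
  rw [← Pop_comb]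
  exact perpGrad_eq h

lemma truncate_inner (g : ℝ → ℝ) (θ R m : ℝ) (ω : E2 → ℝ)
    (hω : ContDiff ℝ 1 ω) (hc : HasCompactSupport ω) (x : E2)
    (hx : ∀ᶠ y in nhds x, cutoff g θ R y = 1) :
    truncate g θ R ω m x = biotSavart2D ω x := by
  have h := stream_hasFDerivAt ω hω hc m R x
  have h2 : HasFDerivAt (fun x => cutoff g θ R x * streamR ω m R x)
      (Aop (biotSavart2D ω x)) x := by
    refine h.congr_of_eventuallyEq ?_
    filter_upwards [hx] with y hy
    simp [hy]
  unfold truncate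
  rw [perpGrad_eq h2, Pop_Aop]

lemma outer_bound (g : ℝ → ℝ) (hg : Differentiable ℝ g) (hg' : Differentiable ℝ (deriv g))
    (hg01 : ∀ t, g t ∈ Set.Icc (0:ℝ) 1)
    (G1 G2 : ℝ) (hG1 : ∀ t, |deriv g t| ≤ G1) (hG2 : ∀ t, |deriv (deriv g) t| ≤ G2)
    (θ R m W : ℝ) (ω : E2 → ℝ)
    (hω : ContDiff ℝ 1 ω) (hc : HasCompactSupport ω) (x : E2) (hx : 1 / 2 ≤ ‖x‖)
    (hr0 : 0 ≤ R ^ (-θ)) (hr1 : R ^ (-θ) ≤ 1) (hW : |streamR ω m R x| ≤ W) :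
    ‖fderiv ℝ (truncate g θ R ω m) x‖ ≤ ‖fderiv ℝ (biotSavart2D ω) x‖ +
      (4 * G1 + G2) * (‖biotSavart2D ω x‖ + W) * R ^ (-θ) := by
  have hp : 0 < ‖x‖ := by linarith
  have hx0 : x ≠ 0 := norm_pos_iff.1 hp
  have hG10 : 0 ≤ G1 := (abs_nonneg _).trans (hG1 0)
  have hG20 : 0 ≤ G2 := (abs_nonneg _).trans (hG2 0)
  have hW0 : 0 ≤ W := (abs_nonneg _).trans hW
  have hev : truncate g θ R ω m =ᶠ[nhds x] fun x => cutoff g θ R x • biotSavart2D ω x +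
      (streamR ω m R x * acoef g θ R x) • perpL x := by
    filter_upwards [isOpen_ne.mem_nhds hx0] with y hy
    exact truncate_near g hg θ R m ω hω hc y hy
  have hu := ((biot_contDiff ω hω hc).differentiable one_ne_zero x).hasFDerivAt
  have h1 := (cutoff_hasFDerivAt g hg θ R x hx0).smul hu
  have h2 := ((stream_hasFDerivAt ω hω hc m R x).mul (acoef_hasFDerivAt g hg' θ R x hx0)).smul
    (perpL.hasFDerivAt (x := x))
  have h3 := h1.add h2
  rw [hev.fderiv_eq]
  erw [h3.fderiv]
  set r := R ^ (-θ) with hr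
  set s := r * (R - ‖x‖) with hs
  set U := ‖biotSavart2D ω x‖
  have hU0 : 0 ≤ U := norm_nonneg _
  have hinv : ‖x‖⁻¹ ≤ 2 := by
    rw [inv_le_comm₀ hp (by norm_num)]; linarith
  have hip : 0 < ‖x‖⁻¹ := inv_pos.2 hp
  have hφ : ‖cutoff g θ R x‖ ≤ 1 := by
    unfold cutoff
    rw [Real.norm_eq_abs, abs_of_nonneg (hg01 _).1]; exact (hg01 _).2
  have ha : |acoef g θ R x| ≤ r * G1 * ‖x‖⁻¹ := by
    unfold acoef
    rw [abs_mul, abs_neg, abs_mul, abs_of_nonneg hr0, abs_of_pos hip]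
    gcongr
    exact hG1 _
  have hax : |acoef g θ R x| * ‖x‖ ≤ r * G1 := by
    calc _ ≤ r * G1 * ‖x‖⁻¹ * ‖x‖ := by gcongr
      _ = _ := by field_simp
  have ha2 : |acoef g θ R x| ≤ r * G1 * 2 := ha.trans (by gcongr)
  have hperp : ‖perpL‖ ≤ 1 := ContinuousLinearMap.opNorm_le_bound _ zero_le_one fun z => by
    rw [perpL_apply, norm_perp, one_mul]
  have hpx : ‖perpL x‖ = ‖x‖ := norm_perp x
  have hA := Aop_norm (biotSavart2D ω x)
  have hd : |r ^ 2 * deriv (deriv g) s * (‖x‖⁻¹ * ‖x‖⁻¹)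
        + (r * deriv g s) * ((‖x‖ ^ 2)⁻¹ * ‖x‖⁻¹)| * ‖x‖ * ‖x‖ ≤ r * G2 + r * G1 * 2 := by
    calc _ ≤ (|r ^ 2 * deriv (deriv g) s * (‖x‖⁻¹ * ‖x‖⁻¹)|
        + |(r * deriv g s) * ((‖x‖ ^ 2)⁻¹ * ‖x‖⁻¹)|) * ‖x‖ * ‖x‖ := by
          gcongr; exact abs_add_le _ _
      _ = r ^ 2 * |deriv (deriv g) s| + r * |deriv g s| * ‖x‖⁻¹ := by
          simp only [abs_mul, abs_of_nonneg hr0, abs_inv, abs_pow, abs_norm]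
          field_simp
      _ ≤ _ := by
          gcongr
          · nlinarith
          · exact hG2 _
          · exact hG1 _
  have T1 := norm_smul_le (cutoff g θ R x) (fderiv ℝ (biotSavart2D ω) x)
  have T1' : ‖cutoff g θ R x‖ * ‖fderiv ℝ (biotSavart2D ω) x‖ ≤ ‖fderiv ℝ (biotSavart2D ω) x‖ :=
    mul_le_of_le_one_left (norm_nonneg _) hφ
  have T2 : ‖(acoef g θ R x • innerSL ℝ x).smulRight (biotSavart2D ω x)‖ ≤ r * G1 * U := by
    rw [ContinuousLinearMap.norm_smulRight_apply, norm_smul, innerSL_apply_norm, Real.norm_eq_abs]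
    gcongr
  have T3 : ‖(streamR ω m R x * acoef g θ R x) • perpL‖ ≤ W * (r * G1 * 2) := by
    rw [norm_smul, norm_mul, Real.norm_eq_abs, Real.norm_eq_abs]
    calc _ ≤ W * (r * G1 * 2) * 1 := by gcongr
      _ = _ := mul_one _
  have T4 : ‖(streamR ω m R x • ((r ^ 2 * deriv (deriv g) s * (‖x‖⁻¹ * ‖x‖⁻¹)
        + (r * deriv g s) * ((‖x‖ ^ 2)⁻¹ * ‖x‖⁻¹)) • innerSL ℝ x) +
        acoef g θ R x • Aop (biotSavart2D ω x)).smulRight (perpL x)‖ ≤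
        W * (r * G2 + r * G1 * 2) + r * G1 * U := by
    rw [ContinuousLinearMap.norm_smulRight_apply, hpx]
    refine (mul_le_mul_of_nonneg_right (norm_add_le _ _) hp.le).trans ?_
    rw [norm_smul, norm_smul, norm_smul, innerSL_apply_norm, Real.norm_eq_abs, Real.norm_eq_abs,
      Real.norm_eq_abs, add_mul]
    refine add_le_add ?_ ?_
    · rw [mul_assoc]
      gcongr
    · calc _ = |acoef g θ R x| * ‖x‖ * ‖Aop (biotSavart2D ω x)‖ := by ring
        _ ≤ _ := by gcongr
  refine (norm_add_le _ _).trans ?_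
  refine (add_le_add (norm_add_le _ _) (norm_add_le _ _)).trans ?_
  refine (add_le_add (add_le_add (T1.trans T1') T2) (add_le_add T3 T4)).trans ?_
  nlinarith [mul_nonneg (mul_nonneg hr0 hG10) hU0, mul_nonneg (mul_nonneg hr0 hG20) hU0]

theorem truncation_gradient_sup_bound (R₀ θ δ₁ : ℝ) (hR₀ : 0 < R₀)
    (hθ : θ ∈ Set.Icc (0:ℝ) 1) (hδ₁ : δ₁ ∈ Set.Ioc (0:ℝ) (1/2))
    (g : ℝ → ℝ) (hg : ContDiff ℝ (⊤ : ℕ∞) g)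
    (hg01 : ∀ t, g t ∈ Set.Icc (0:ℝ) 1)
    (hg0 : ∀ t ≤ (0:ℝ), g t = 0)
    (hg1 : ∀ t, δ₁ / 2 ≤ t → g t = 1) :
    ∃ C > 0, ∀ ω : EuclideanSpace ℝ (Fin 2) → ℝ,
      ContDiff ℝ 1 ω →
      Function.support ω ⊆ Metric.closedBall 0 R₀ →
      ∀ R : ℝ, max (4 * R₀) 1 ≤ R →
        ∀ x ∈ Metric.ball (0 : EuclideanSpace ℝ (Fin 2)) R,
          ‖fderiv ℝ (truncate g θ R ω (∫ y, ω y)) x‖ ≤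
            (⨆ y, ‖fderiv ℝ (biotSavart2D ω) y‖) +
              C * ((⨆ y, ‖biotSavart2D ω y‖) + ∫ y, |ω y|) * R ^ (-θ) := by
  have hgd : Differentiable ℝ g := hg.differentiable (by simp)
  have hg1c : ContDiff ℝ (⊤ : ℕ∞) (deriv g) := ((contDiff_infty_iff_deriv).1 hg).2
  have hgd' : Differentiable ℝ (deriv g) := hg1c.differentiable (by simp)
  have hg2c : ContDiff ℝ (⊤ : ℕ∞) (deriv (deriv g)) := ((contDiff_infty_iff_deriv).1 hg1c).2
  obtain ⟨⟨G1, hG1⟩, hd0, hd1⟩ := deriv_bdd g 0 1 (δ₁ / 2) hg1c.continuous hg0 hg1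
  obtain ⟨⟨G2, hG2⟩, -, -⟩ := deriv_bdd (deriv g) 0 0 (δ₁ / 2) hg2c.continuous hd0 hd1
  have hG10 : 0 ≤ G1 := (abs_nonneg _).trans (hG1 0)
  have hG20 : 0 ≤ G2 := (abs_nonneg _).trans (hG2 0)
  refine ⟨4 * G1 + G2 + 1, by positivity, ?_⟩
  intro ω hω hs R hR x hx
  have hR0 : 4 * R₀ ≤ R := (le_max_left _ _).trans hR
  have hR1 : 1 ≤ R := (le_max_right _ _).trans hR
  have hRp : 0 < R := by linarith
  have hc : HasCompactSupport ω := HasCompactSupport.intro (isCompact_closedBall 0 R₀)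
    fun y hy => by
      by_contra h
      exact hy (hs h)
  have hr0 : 0 ≤ R ^ (-θ) := Real.rpow_nonneg hRp.le _
  have hr1 : R ^ (-θ) ≤ 1 := Real.rpow_le_one_of_one_le_of_nonpos hR1 (by linarith [hθ.1])
  have hD := le_ciSup (biot_fderiv_bdd ω hω hc) x
  have hU := le_ciSup (biot_bdd ω hω hc) x
  have hW0 : 0 ≤ ∫ y, |ω y| := integral_nonneg fun y => abs_nonneg _
  have hU0 : 0 ≤ ⨆ y, ‖biotSavart2D ω y‖ := (norm_nonneg _).trans hU
  have hxR : ‖x‖ < R := by simpa using hx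
  by_cases hx1 : ‖x‖ < 3 * R / 4
  · have hone : ∀ y : EuclideanSpace ℝ (Fin 2), ‖y‖ < 3 * R / 4 → cutoff g θ R y = 1 := by
      intro y hy
      refine hg1 _ ?_
      have h1 : 1 ≤ R ^ (-θ) * R := by
        have := Real.rpow_add_one hRp.ne' (-θ)
        rw [← this]
        exact Real.one_le_rpow hR1 (by linarith [hθ.2])
      have h2 : R ^ (-θ) * (R / 4) ≤ R ^ (-θ) * (R - ‖y‖) := by
        gcongr; linarith
      linarith [hδ₁.2]
    have hnb : ∀ y : EuclideanSpace ℝ (Fin 2), ‖y‖ < 3 * R / 4 → ∀ᶠ z in nhds y, ‖z‖ < 3 * R / 4 :=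
      fun y hy => (isOpen_lt continuous_norm continuous_const).mem_nhds hy
    have hev : truncate g θ R ω (∫ y, ω y) =ᶠ[nhds x] biotSavart2D ω := by
      filter_upwards [hnb x hx1] with y hy
      exact truncate_inner g θ R _ ω hω hc y ((hnb y hy).mono hone)
    rw [hev.fderiv_eq]
    have : 0 ≤ (4 * G1 + G2 + 1) * ((⨆ y, ‖biotSavart2D ω y‖) + ∫ y, |ω y|) * R ^ (-θ) := by
      positivity
    linarith
  · push Not at hx1
    have hW := stream_bound ω hω hc R₀ R hs hRp hR0 x hx1 hxR.le
    refine (outer_bound g hgd hgd' hg01 G1 G2 hG1 hG2 θ R _ _ ω hω hc x (by linarith)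
      hr0 hr1 hW).trans ?_
    refine add_le_add hD ?_
    refine mul_le_mul_of_nonneg_right ?_ hr0
    exact mul_le_mul (by linarith) (by linarith) (by positivity) (by positivity)
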